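/- Let f = x³z³ + y³z² + y² in ℚ[x,y,z]. For every b ∈ ℚ[s], b satisfies the Bernstein–Sato functional equation for the pair (f, 1) if and only if (s + 5/6)²(s + 1)(s + 7/6)²(s + 3/2) divides b in ℚ[s]; that is, b_f(s) = (s + 5/6)²(s + 1)(s + 7/6)²(s + 3/2). -/

import Mathlib

open MvPolynomial Polynomial

/-- The iterated formal partial derivative `∂^α = ∏ᵢ ∂_{xᵢ}^{αᵢ}` applied to a
multivariate polynomial (the partial derivatives pairwise commute, so the order
of the fold is immaterial). -/
noncomputable def pdIter {σ : Type*} [Fintype σ] (α : σ → ℕ)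
    (p : MvPolynomial σ ℚ) : MvPolynomial σ ℚ :=
  Finset.univ.toList.foldl (fun q i => (⇑(MvPolynomial.pderiv i))^[α i] q) p

/-- `b ∈ ℚ[s]` satisfies the Bernstein–Sato functional equation for the pair
`(f, g)`: there are finitely many multi-indices `α` and polynomials
`p_α ∈ (ℚ[x])[s]` with `b(m)·g·f^m = Σ_α p_α(m)·∂^α(g·f^(m+1))` for all `m ∈ ℕ`. -/
def SatisfiesBS {σ : Type*} [Fintype σ] (f g : MvPolynomial σ ℚ)
    (b : Polynomial ℚ) : Prop :=
  ∃ (A : Finset (σ → ℕ)) (p : (σ → ℕ) → Polynomial (MvPolynomial σ ℚ)),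
    ∀ m : ℕ,
      MvPolynomial.C (Polynomial.eval (m : ℚ) b) * g * f ^ m =
        ∑ α ∈ A, Polynomial.eval ((m : ℕ) : MvPolynomial σ ℚ) (p α) *
          pdIter α (g * f ^ (m + 1))

lemma pderiv_comm {σ R : Type*} [CommSemiring R] (i j : σ) (p : MvPolynomial σ R) :
    pderiv i (pderiv j p) = pderiv j (pderiv i p) := by
  induction p using MvPolynomial.induction_on with
  | C a => simp
  | add p q hp hq => simp [hp, hq]
  | mul_X p k hp =>
    classical
    have h (i j : σ) : pderiv i ((Pi.single j 1 : σ → MvPolynomial σ R) k) = 0 := by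
      rcases eq_or_ne k j with rfl | hk
      · simp
      · simp [hk]
    simp only [Derivation.leibniz, smul_eq_mul, map_add, pderiv_X, hp, h]
    ring

section Iterated

variable {σ : Type*}

/-- The composite of the powers `∂ᵢ ^ αᵢ` for `i` ranging over a list. -/
noncomputable def pdFold (l : List σ) (α : σ → ℕ) (p : MvPolynomial σ ℚ) : MvPolynomial σ ℚ :=
  l.foldl (fun q i => (⇑(pderiv i))^[α i] q) p

lemma pderiv_pdFold (i : σ) (l : List σ) (α : σ → ℕ) (p : MvPolynomial σ ℚ) :
    pderiv i (pdFold l α p) = pdFold l α (pderiv i p) := by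
  induction l generalizing p with
  | nil => rfl
  | cons j l ih =>
    have h : Function.Commute (⇑(pderiv (R := ℚ) i)) (⇑(pderiv j))^[α j] :=
      Function.Commute.iterate_right (fun q => pderiv_comm i j q) _
    change pderiv i (pdFold l α ((⇑(pderiv j))^[α j] p)) = pdFold l α ((⇑(pderiv j))^[α j] _)
    rw [ih, h.eq]

lemma pdFold_add_single_of_notMem [DecidableEq σ] {i : σ} {l : List σ} (hi : i ∉ l) (α : σ → ℕ)
    (p : MvPolynomial σ ℚ) : pdFold l (α + Pi.single i 1) p = pdFold l α p := by
  induction l generalizing p with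
  | nil => rfl
  | cons j l ih =>
    rw [List.mem_cons, not_or] at hi
    change pdFold l _ ((⇑(pderiv j))^[(α + Pi.single i 1 : σ → ℕ) j] p) =
      pdFold l α ((⇑(pderiv j))^[α j] p)
    rw [ih hi.2]
    simp [Ne.symm hi.1]

lemma pdFold_add_single_of_mem [DecidableEq σ] {i : σ} {l : List σ} (hl : l.Nodup) (hi : i ∈ l)
    (α : σ → ℕ) (p : MvPolynomial σ ℚ) :
    pdFold l (α + Pi.single i 1) p = pderiv i (pdFold l α p) := by
  induction l generalizing p with
  | nil => simp at hi
  | cons j l ih =>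
    rw [List.nodup_cons] at hl
    change pdFold l _ ((⇑(pderiv j))^[(α + Pi.single i 1 : σ → ℕ) j] p) =
      pderiv i (pdFold l α ((⇑(pderiv j))^[α j] p))
    rcases eq_or_ne i j with rfl | hij
    · rw [pdFold_add_single_of_notMem hl.1, pderiv_pdFold]
      simp [Function.iterate_succ_apply']
    · rw [ih hl.2 ((List.mem_cons.1 hi).resolve_left hij)]
      simp [hij.symm]

lemma pderiv_pdIter [Fintype σ] [DecidableEq σ] (i : σ) (α : σ → ℕ) (p : MvPolynomial σ ℚ) :
    pderiv i (pdIter α p) = pdIter (α + Pi.single i 1) p :=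
  (pdFold_add_single_of_mem (Finset.nodup_toList _) (by simp) α p).symm

lemma pdFold_zero (l : List σ) (p : MvPolynomial σ ℚ) : pdFold l 0 p = p := by
  induction l with
  | nil => rfl
  | cons j l ih => exact ih

lemma exists_eval_eq_pderiv_eval (i : σ) (q : Polynomial (MvPolynomial σ ℚ)) :
    ∃ q' : Polynomial (MvPolynomial σ ℚ),
      ∀ m : ℕ, q'.eval (m : MvPolynomial σ ℚ) = pderiv i (q.eval (m : MvPolynomial σ ℚ)) := by
  induction q using Polynomial.induction_on' with
  | add p q hp hq =>
    obtain ⟨p', hp⟩ := hp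
    obtain ⟨q', hq⟩ := hq
    exact ⟨p' + q', fun m => by simp [hp, hq]⟩
  | monomial n a =>
    refine ⟨Polynomial.monomial n (pderiv i a), fun m => ?_⟩
    simp [Polynomial.eval_monomial, Derivation.leibniz, Derivation.leibniz_pow, mul_comm]

end Iterated

section FunctionalEquation

variable {σ : Type*} [Fintype σ]

/-- The sequences `m ↦ P(m) f ^ (m + 1)` with `P` a differential operator with coefficients
polynomial in `m`; this models the module `D[s] f ^ (s + 1)`. -/
noncomputable def bsModule (f : MvPolynomial σ ℚ) : AddSubmonoid (ℕ → MvPolynomial σ ℚ) :=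
  AddSubmonoid.closure {h | ∃ (q : Polynomial (MvPolynomial σ ℚ)) (α : σ → ℕ),
    h = fun m : ℕ => q.eval (m : MvPolynomial σ ℚ) * pdIter α (f ^ (m + 1))}

variable {f : MvPolynomial σ ℚ}

lemma pow_succ_mem_bsModule : (fun m => f ^ (m + 1)) ∈ bsModule f := by
  refine AddSubmonoid.subset_closure ⟨1, 0, funext fun m => ?_⟩
  rw [Polynomial.eval_one, one_mul]
  exact (pdFold_zero _ _).symm

lemma eval_mul_mem_bsModule (q : Polynomial (MvPolynomial σ ℚ)) {h : ℕ → MvPolynomial σ ℚ}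
    (hh : h ∈ bsModule f) :
    (fun m : ℕ => q.eval (m : MvPolynomial σ ℚ) * h m) ∈ bsModule f := by
  induction hh using AddSubmonoid.closure_induction with
  | mem h hh =>
    obtain ⟨p, α, rfl⟩ := hh
    exact AddSubmonoid.subset_closure ⟨q * p, α, funext fun m => by simp [mul_assoc]⟩
  | zero =>
    convert (bsModule f).zero_mem using 1
    funext m
    simp
  | add x y _ _ hx hy =>
    convert (bsModule f).add_mem hx hy using 1
    exact funext fun m => mul_add _ _ _

lemma mul_mem_bsModule (g : MvPolynomial σ ℚ) {h : ℕ → MvPolynomial σ ℚ}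
    (hh : h ∈ bsModule f) : (fun m => g * h m) ∈ bsModule f := by
  simpa using eval_mul_mem_bsModule (Polynomial.C g) hh

lemma pderiv_mem_bsModule (i : σ) {h : ℕ → MvPolynomial σ ℚ} (hh : h ∈ bsModule f) :
    (fun m => pderiv i (h m)) ∈ bsModule f := by
  classical
  induction hh using AddSubmonoid.closure_induction with
  | mem h hh =>
    obtain ⟨q, α, rfl⟩ := hh
    obtain ⟨q', hq'⟩ := exists_eval_eq_pderiv_eval i q
    have h1 : (fun m : ℕ => q.eval (m : MvPolynomial σ ℚ) *
        pdIter (α + Pi.single i 1) (f ^ (m + 1))) ∈ bsModule f :=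
      AddSubmonoid.subset_closure ⟨q, _, rfl⟩
    have h2 : (fun m : ℕ => q'.eval (m : MvPolynomial σ ℚ) * pdIter α (f ^ (m + 1))) ∈
        bsModule f := AddSubmonoid.subset_closure ⟨q', _, rfl⟩
    convert (bsModule f).add_mem h1 h2 using 1
    funext m
    simp only [Pi.add_apply, Derivation.leibniz, smul_eq_mul, pderiv_pdIter, hq']
    ring
  | zero =>
    convert (bsModule f).zero_mem using 1
    funext m
    simp
  | add x y _ _ hx hy =>
    convert (bsModule f).add_mem hx hy using 1
    exact funext fun m => map_add _ _ _

lemma exists_sum_eq_of_mem_bsModule {h : ℕ → MvPolynomial σ ℚ} (hh : h ∈ bsModule f) :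
    ∃ (A : Finset (σ → ℕ)) (p : (σ → ℕ) → Polynomial (MvPolynomial σ ℚ)), ∀ m : ℕ,
      h m = ∑ α ∈ A, (p α).eval (m : MvPolynomial σ ℚ) * pdIter α (f ^ (m + 1)) := by
  classical
  suffices ∃ P : (σ → ℕ) →₀ Polynomial (MvPolynomial σ ℚ), ∀ m : ℕ,
      h m = P.sum fun α q => q.eval (m : MvPolynomial σ ℚ) * pdIter α (f ^ (m + 1)) by
    obtain ⟨P, hP⟩ := this
    exact ⟨P.support, P, hP⟩
  induction hh using AddSubmonoid.closure_induction with
  | mem h hh =>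
    obtain ⟨q, α, rfl⟩ := hh
    exact ⟨Finsupp.single α q, fun m => by simp⟩
  | zero => exact ⟨0, fun m => by simp⟩
  | add x y _ _ hx hy =>
    obtain ⟨P, hP⟩ := hx
    obtain ⟨Q, hQ⟩ := hy
    refine ⟨P + Q, fun m => ?_⟩
    rw [Finsupp.sum_add_index' (by simp) (by simp [add_mul]), Pi.add_apply, hP, hQ]

lemma satisfiesBS_of_mem_bsModule {b : Polynomial ℚ}
    (h : (fun m : ℕ => MvPolynomial.C (b.eval (m : ℚ)) * f ^ m) ∈ bsModule f) :
    SatisfiesBS f 1 b := by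
  obtain ⟨A, p, hp⟩ := exists_sum_eq_of_mem_bsModule h
  exact ⟨A, p, fun m => by simpa using hp m⟩

lemma succ_mul_pderiv_mem_bsModule (i : σ) :
    (fun m : ℕ => ((m : MvPolynomial σ ℚ) + 1) * (pderiv i f * f ^ m)) ∈ bsModule f := by
  convert pderiv_mem_bsModule i (pow_succ_mem_bsModule (f := f)) using 1
  funext m
  simp only [Derivation.leibniz_pow, Nat.add_sub_cancel, smul_eq_mul, nsmul_eq_mul, Nat.cast_add,
    Nat.cast_one]
  ring

end FunctionalEquation

section UpperBound

/-- The polynomial `x³z³ + y³z² + y²`. -/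
noncomputable def bsPoly : MvPolynomial (Fin 3) ℚ :=
  (X 0) ^ 3 * (X 2) ^ 3 + (X 1) ^ 3 * (X 2) ^ 2 + (X 1) ^ 2

lemma bsPoly_ne_zero : bsPoly ≠ 0 := fun h => by
  simpa [bsPoly] using congr(MvPolynomial.eval ![0, 1, 0] $h)

lemma pderiv_zero_bsPoly : pderiv 0 bsPoly = 3 * X 0 ^ 2 * X 2 ^ 3 := by
  simp [bsPoly, Derivation.leibniz, Derivation.leibniz_pow, pderiv_X]
  ring

lemma pderiv_one_bsPoly : pderiv 1 bsPoly = 2 * X 1 + 3 * X 1 ^ 2 * X 2 ^ 2 := by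
  simp [bsPoly, Derivation.leibniz, Derivation.leibniz_pow, pderiv_X]
  ring

lemma pderiv_two_bsPoly : pderiv 2 bsPoly = 3 * X 0 ^ 3 * X 2 ^ 2 + 2 * X 1 ^ 3 * X 2 := by
  simp [bsPoly, Derivation.leibniz, Derivation.leibniz_pow, pderiv_X]
  ring

lemma X_one_eq_jacobian_combination : (X 1 : MvPolynomial (Fin 3) ℚ) =
    (MvPolynomial.C (1 / 2) - MvPolynomial.C (3 / 4) * X 2 ^ 2 * X 1) * pderiv 1 bsPoly +
      -(MvPolynomial.C (9 / 8) * X 2 ^ 2 * X 0) * pderiv 0 bsPoly +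
      MvPolynomial.C (9 / 8) * X 2 ^ 3 * pderiv 2 bsPoly := by
  rw [pderiv_zero_bsPoly, pderiv_one_bsPoly, pderiv_two_bsPoly]
  have h1 : (MvPolynomial.C (1 / 2) : MvPolynomial (Fin 3) ℚ) * 2 = 1 := by
    rw [← map_ofNat MvPolynomial.C 2, ← MvPolynomial.C_mul]; norm_num
  have h2 : (MvPolynomial.C (3 / 4) : MvPolynomial (Fin 3) ℚ) =
      MvPolynomial.C (1 / 2) * MvPolynomial.C (1 / 2) * 3 := by
    rw [← map_ofNat MvPolynomial.C 3, ← MvPolynomial.C_mul, ← MvPolynomial.C_mul]; norm_num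
  have h3 : (MvPolynomial.C (9 / 8) : MvPolynomial (Fin 3) ℚ) =
      MvPolynomial.C (1 / 2) * MvPolynomial.C (1 / 2) * MvPolynomial.C (1 / 2) * 9 := by
    rw [← map_ofNat MvPolynomial.C 9, ← MvPolynomial.C_mul, ← MvPolynomial.C_mul,
      ← MvPolynomial.C_mul]
    norm_num
  rw [h2, h3]
  generalize (MvPolynomial.C (1 / 2) : MvPolynomial (Fin 3) ℚ) = c at *
  grind

lemma succ_mul_X_one_mem (g : MvPolynomial (Fin 3) ℚ) :
    (fun m : ℕ => ((m : MvPolynomial (Fin 3) ℚ) + 1) * (X 1 * g * bsPoly ^ m)) ∈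
      bsModule bsPoly := by
  have h (i : Fin 3) (r : MvPolynomial (Fin 3) ℚ) :=
    mul_mem_bsModule r (succ_mul_pderiv_mem_bsModule (f := bsPoly) i)
  convert (bsModule bsPoly).add_mem ((bsModule bsPoly).add_mem
    (h 1 (g * (MvPolynomial.C (1 / 2) - MvPolynomial.C (3 / 4) * X 2 ^ 2 * X 1)))
    (h 0 (g * -(MvPolynomial.C (9 / 8) * X 2 ^ 2 * X 0))))
    (h 2 (g * (MvPolynomial.C (9 / 8) * X 2 ^ 3))) using 1
  funext m
  conv_lhs => rw [X_one_eq_jacobian_combination]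
  simp only [Pi.add_apply]
  ring

lemma succ_mul_X_zero_pow_three_mem :
    (fun m : ℕ => ((m : MvPolynomial (Fin 3) ℚ) + 1) * (X 0 ^ 3 * X 2 ^ 2 * bsPoly ^ m)) ∈
      bsModule bsPoly := by
  convert mul_mem_bsModule (MvPolynomial.C (1 / 3)) ((bsModule bsPoly).add_mem
    (succ_mul_pderiv_mem_bsModule (f := bsPoly) 2)
    (succ_mul_X_one_mem (-2 * X 1 ^ 2 * X 2))) using 1
  funext m
  have h : (MvPolynomial.C (1 / 3) : MvPolynomial (Fin 3) ℚ) * 3 = 1 := by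
    rw [← map_ofNat MvPolynomial.C 3, ← MvPolynomial.C_mul]; norm_num
  simp only [Pi.add_apply]
  rw [pderiv_two_bsPoly]
  linear_combination (-((m : MvPolynomial (Fin 3) ℚ) + 1) * (X 0 ^ 3 * X 2 ^ 2 * bsPoly ^ m)) * h

lemma euler_bsPoly_pow (m : ℕ) :
    7 * X 0 * pderiv 0 (bsPoly ^ m) + 6 * X 1 * pderiv 1 (bsPoly ^ m) -
      3 * X 2 * pderiv 2 (bsPoly ^ m) = 12 * (m : MvPolynomial (Fin 3) ℚ) * bsPoly ^ m := by
  cases m with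
  | zero => simp
  | succ m =>
    simp only [pderiv_pow, pderiv_zero_bsPoly, pderiv_one_bsPoly, pderiv_two_bsPoly,
      Nat.add_sub_cancel]
    rw [pow_succ bsPoly m]
    generalize bsPoly ^ m = F
    rw [bsPoly]
    push_cast
    ring

lemma vertical_field_bsPoly_pow (m : ℕ) :
    (2 + 3 * X 1 * X 2 ^ 2) * (X 0 * pderiv 0 (bsPoly ^ m) - X 2 * pderiv 2 (bsPoly ^ m)) +
      2 * X 1 ^ 2 * X 2 ^ 2 * pderiv 1 (bsPoly ^ m) = 0 := by
  simp only [pderiv_pow, pderiv_zero_bsPoly, pderiv_one_bsPoly, pderiv_two_bsPoly]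
  ring

lemma succ_mul_torus_field_mem :
    (fun m : ℕ => ((m : MvPolynomial (Fin 3) ℚ) + 1) *
      (X 0 * pderiv 0 (bsPoly ^ m) - X 2 * pderiv 2 (bsPoly ^ m))) ∈ bsModule bsPoly := by
  have h0 := pderiv_mem_bsModule 0 (succ_mul_X_one_mem (-3 * X 0 * X 2 ^ 2))
  have h2 := pderiv_mem_bsModule 2 (succ_mul_X_one_mem (3 * X 2 ^ 3))
  have h1 := pderiv_mem_bsModule 1 (succ_mul_X_one_mem (-2 * X 1 * X 2 ^ 2))
  have h := succ_mul_X_one_mem (-2 * X 2 ^ 2)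
  convert mul_mem_bsModule (MvPolynomial.C (1 / 2))
    ((bsModule bsPoly).add_mem ((bsModule bsPoly).add_mem
      ((bsModule bsPoly).add_mem h0 h1) h2) h) using 1
  funext m
  have hc : (MvPolynomial.C (1 / 2) : MvPolynomial (Fin 3) ℚ) * 2 = 1 := by
    rw [← map_ofNat MvPolynomial.C 2, ← MvPolynomial.C_mul]; norm_num
  have hv := vertical_field_bsPoly_pow m
  have hn2 (i : Fin 3) : pderiv i (2 : MvPolynomial (Fin 3) ℚ) = 0 := by
    simpa using (pderiv i).map_natCast 2
  have hn3 (i : Fin 3) : pderiv i (3 : MvPolynomial (Fin 3) ℚ) = 0 := by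
    simpa using (pderiv i).map_natCast 3
  simp only [Pi.add_apply]
  generalize bsPoly ^ m = F at *
  generalize (MvPolynomial.C (1 / 2) : MvPolynomial (Fin 3) ℚ) = c at *
  simp [Derivation.leibniz, pderiv_X, Derivation.leibniz_pow, hn2, hn3]
  linear_combination
    (-((m : MvPolynomial (Fin 3) ℚ) + 1) * (X 0 * pderiv 0 F - X 2 * pderiv 2 F)) * hc +
      c * ((m : MvPolynomial (Fin 3) ℚ) + 1) * hv

lemma succ_mul_logarithmic_mem {l : Fin 3} (hl : l = 0 ∨ l = 2) :
    (fun m : ℕ => ((m : MvPolynomial (Fin 3) ℚ) + 1) *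
      ((12 * (m : MvPolynomial (Fin 3) ℚ) + 6) * bsPoly ^ m -
        4 * (X l * pderiv l (bsPoly ^ m)))) ∈ bsModule bsPoly := by
  have hy := mul_mem_bsModule 6 (pderiv_mem_bsModule 1 (succ_mul_X_one_mem 1))
  have hsum (k : MvPolynomial (Fin 3) ℚ) :=
    (bsModule bsPoly).add_mem (mul_mem_bsModule k succ_mul_torus_field_mem) hy
  rcases hl with rfl | rfl
  · convert hsum 3 using 1
    funext m
    have he := euler_bsPoly_pow m
    simp only [Pi.add_apply]
    generalize bsPoly ^ m = F at *
    simp [Derivation.leibniz, pderiv_X]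
    linear_combination (-((m : MvPolynomial (Fin 3) ℚ) + 1)) * he
  · convert hsum 7 using 1
    funext m
    have he := euler_bsPoly_pow m
    simp only [Pi.add_apply]
    generalize bsPoly ^ m = F at *
    simp [Derivation.leibniz, pderiv_X]
    linear_combination (-((m : MvPolynomial (Fin 3) ℚ) + 1)) * he

lemma eval_mul_mem_of_X_mul {l : Fin 3} (hl : l = 0 ∨ l = 2) {g : MvPolynomial (Fin 3) ℚ} (a : ℚ)
    (hg : X l * pderiv l g = MvPolynomial.C a * g) {q : ℚ[X]} (hq : Polynomial.X + 1 ∣ q)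
    (h : (fun m : ℕ => MvPolynomial.C (q.eval (m : ℚ)) * (X l * g * bsPoly ^ m)) ∈
      bsModule bsPoly) :
    (fun m : ℕ =>
      MvPolynomial.C ((q * (Polynomial.X + Polynomial.C (5 / 6 + a / 3))).eval (m : ℚ)) *
        (g * bsPoly ^ m)) ∈ bsModule bsPoly := by
  obtain ⟨p, rfl⟩ := hq
  convert (bsModule bsPoly).add_mem
    (eval_mul_mem_bsModule (p.map MvPolynomial.C)
      (mul_mem_bsModule (MvPolynomial.C (1 / 12) * g) (succ_mul_logarithmic_mem hl)))
    (mul_mem_bsModule (MvPolynomial.C (1 / 3)) (pderiv_mem_bsModule l h)) using 1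
  funext m
  simp only [Pi.add_apply]
  have h3 : (MvPolynomial.C (1 / 3) : MvPolynomial (Fin 3) ℚ) = MvPolynomial.C (1 / 12) * 4 := by
    rw [← map_ofNat MvPolynomial.C 4, ← MvPolynomial.C_mul]; norm_num
  have h6 : (MvPolynomial.C (5 / 6 + a / 3) : MvPolynomial (Fin 3) ℚ) =
      MvPolynomial.C (1 / 12) * (10 + 4 * MvPolynomial.C a) := by
    rw [← map_ofNat MvPolynomial.C 4, ← map_ofNat MvPolynomial.C 10, ← MvPolynomial.C_mul,
      ← MvPolynomial.C_add, ← MvPolynomial.C_mul]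
    congr 1
    ring
  have h12 : (MvPolynomial.C (1 / 12) : MvPolynomial (Fin 3) ℚ) * 12 = 1 := by
    rw [← map_ofNat MvPolynomial.C 12, ← MvPolynomial.C_mul]; norm_num
  have hp : (p.map (MvPolynomial.C (σ := Fin 3))).eval (m : MvPolynomial (Fin 3) ℚ) =
      MvPolynomial.C (p.eval (m : ℚ)) := by
    rw [← map_natCast (MvPolynomial.C (σ := Fin 3)) m, Polynomial.eval_map_apply]
  rw [hp, h3]
  simp only [Polynomial.eval_mul, Polynomial.eval_add, Polynomial.eval_X, Polynomial.eval_C,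
    Polynomial.eval_one, MvPolynomial.C_mul, MvPolynomial.C_add, h6, map_natCast, map_one]
  generalize bsPoly ^ m = F
  rw [show ((m : MvPolynomial (Fin 3) ℚ) + 1) * MvPolynomial.C (p.eval (m : ℚ)) =
    MvPolynomial.C ((m + 1) * p.eval (m : ℚ)) by simp, pderiv_C_mul]
  simp only [Derivation.leibniz, smul_eq_mul, pderiv_X_self, map_mul, map_add, map_one, map_natCast]
  generalize (MvPolynomial.C (1 / 12) : MvPolynomial (Fin 3) ℚ) = c at *
  generalize (MvPolynomial.C (p.eval (m : ℚ)) : MvPolynomial (Fin 3) ℚ) = P at *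
  linear_combination (-P * (m + 1) * m * g * F) * h12 - (4 * c * P * (m + 1) * F) * hg

lemma satisfiesBS_bsPoly_of_dvd {b : ℚ[X]}
    (hb : (Polynomial.X + Polynomial.C (5 / 6 : ℚ)) ^ 2 *
      (Polynomial.X + Polynomial.C (1 : ℚ)) * (Polynomial.X + Polynomial.C (7 / 6 : ℚ)) ^ 2 *
      (Polynomial.X + Polynomial.C (3 / 2 : ℚ)) ∣ b) : SatisfiesBS bsPoly 1 b := by
  have h0 : (fun m : ℕ => MvPolynomial.C ((Polynomial.X + 1 : ℚ[X]).eval (m : ℚ)) *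
      (X 0 * (X 0 ^ 2 * X 2 ^ 2) * bsPoly ^ m)) ∈ bsModule bsPoly := by
    convert succ_mul_X_zero_pow_three_mem using 1
    funext m
    simp only [Polynomial.eval_add, Polynomial.eval_X, Polynomial.eval_one, map_add, map_one,
      map_natCast]
    ring
  have h1 := eval_mul_mem_of_X_mul (.inl rfl) 2
    (by simp [Derivation.leibniz, Derivation.leibniz_pow, pderiv_X, map_ofNat]; ring) dvd_rfl h0
  rw [show (X 0 ^ 2 * X 2 ^ 2 : MvPolynomial (Fin 3) ℚ) = X 2 * (X 0 ^ 2 * X 2) by ring] at h1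
  have h2 := eval_mul_mem_of_X_mul (.inr rfl) 1
    (by simp [Derivation.leibniz, Derivation.leibniz_pow, pderiv_X]; ring) (dvd_mul_right _ _) h1
  rw [show (X 0 ^ 2 * X 2 : MvPolynomial (Fin 3) ℚ) = X 0 * (X 0 * X 2) by ring] at h2
  have h3 := eval_mul_mem_of_X_mul (.inl rfl) 1
    (by simp [Derivation.leibniz, pderiv_X]) ((dvd_mul_right _ _).mul_right _) h2
  rw [show (X 0 * X 2 : MvPolynomial (Fin 3) ℚ) = X 2 * X 0 by ring] at h3
  have h4 := eval_mul_mem_of_X_mul (.inr rfl) 0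
    (by simp [pderiv_X]) (((dvd_mul_right _ _).mul_right _).mul_right _) h3
  rw [← mul_one (X 0 : MvPolynomial (Fin 3) ℚ)] at h4
  have h5 := eval_mul_mem_of_X_mul (.inl rfl) 0
    (by simp) ((((dvd_mul_right _ _).mul_right _).mul_right _).mul_right _) h4
  obtain ⟨c, rfl⟩ := hb
  refine satisfiesBS_of_mem_bsModule ?_
  convert eval_mul_mem_bsModule (c.map MvPolynomial.C) h5 using 1
  funext m
  rw [← map_natCast (MvPolynomial.C (σ := Fin 3)) m, Polynomial.eval_map_apply, ← mul_assoc,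
    ← MvPolynomial.C_mul, one_mul]
  congr 2
  simp only [Polynomial.eval_mul, Polynomial.eval_add, Polynomial.eval_pow, Polynomial.eval_X,
    Polynomial.eval_C, Polynomial.eval_one]
  ring

end UpperBound

section Specialization

variable {σ F V : Type*} [Field F] [AddCommGroup V] [Module F V]
  {f : MvPolynomial σ ℚ} {E : (MvPolynomial σ ℚ)[X] →+* Module.End F V}
  {D : σ → Module.End F V} {s : F} {w : ℤ → V} {N : AddSubgroup V}

lemma exists_eval_and_map_eq_pderiv (hs : ∀ v, E Polynomial.X v = s • v)
    (hD : ∀ i h v, D i (E (Polynomial.C h) v) =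
      E (Polynomial.C h) (D i v) + E (Polynomial.C (pderiv i h)) v)
    (i : σ) (q : (MvPolynomial σ ℚ)[X]) :
    ∃ q' : (MvPolynomial σ ℚ)[X],
      (∀ m : ℤ, q'.eval (m : MvPolynomial σ ℚ) = pderiv i (q.eval (m : MvPolynomial σ ℚ))) ∧
      ∀ v, D i (E q v) = E q (D i v) + E q' v := by
  have hX (n : ℕ) (v : V) : E (Polynomial.X ^ n) v = s ^ n • v := by
    induction n with
    | zero => simp
    | succ n ih =>
      rw [pow_succ, map_mul, Module.End.mul_apply, hs, map_smul, ih, smul_smul, pow_succ']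
  induction q using Polynomial.induction_on' with
  | add p q hp hq =>
    obtain ⟨p', hp, hp'⟩ := hp
    obtain ⟨q', hq, hq'⟩ := hq
    refine ⟨p' + q', fun m => by simp [hp, hq], fun v => ?_⟩
    simp only [map_add, LinearMap.add_apply, hp', hq']
    abel
  | monomial n a =>
    refine ⟨Polynomial.monomial n (pderiv i a), fun m => ?_, fun v => ?_⟩
    · simp [Polynomial.eval_monomial, Derivation.leibniz, Derivation.leibniz_pow, mul_comm]
    · simp only [← Polynomial.C_mul_X_pow_eq_monomial, map_mul, Module.End.mul_apply, hD]
      simp only [hX, map_smul]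

lemma exists_pdIter_pow_eq [Fintype σ] [DecidableEq σ] (hs : ∀ v, E Polynomial.X v = s • v)
    (hD : ∀ i h v, D i (E (Polynomial.C h) v) =
      E (Polynomial.C h) (D i v) + E (Polynomial.C (pderiv i h)) v)
    (hw : ∀ i, E (Polynomial.C f) (w i) = w (i + 1))
    (hDw : ∀ l i, D l (w (i + 1)) = (s + i + 1) • E (Polynomial.C (pderiv l f)) (w i))
    (hN : w 1 ∈ N) (hND : ∀ l, ∀ v ∈ N, D l v ∈ N) (α : σ → ℕ) :
    ∃ (k : ℕ) (q : (MvPolynomial σ ℚ)[X]),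
      (∀ m : ℕ, k ≤ m + 1 →
        pdIter α (f ^ (m + 1)) = q.eval (m : MvPolynomial σ ℚ) * f ^ (m + 1 - k)) ∧
      f ^ k ∣ q.eval (-1) ∧ E q (w (1 - k)) ∈ N := by
  obtain ⟨n, hn⟩ : ∃ n, ∑ i, α i = n := ⟨_, rfl⟩
  induction n generalizing α with
  | zero =>
    have hα : α = 0 := funext fun i => by simpa using Finset.sum_eq_zero_iff.1 hn i
    subst hα
    exact ⟨0, 1, fun m _ => by rw [Polynomial.eval_one, one_mul]; exact pdFold_zero _ _,
      by simp, by simpa using hN⟩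
  | succ n ih =>
    obtain ⟨i, hi⟩ : ∃ i, α i ≠ 0 := by
      by_contra! h
      simp [h] at hn
    obtain ⟨β, rfl⟩ : ∃ β : σ → ℕ, α = β + Pi.single i 1 := by
      refine ⟨α - Pi.single i 1, (tsub_add_cancel_of_le fun j => ?_).symm⟩
      rcases eq_or_ne j i with rfl | hj
      · simpa using Nat.one_le_iff_ne_zero.2 hi
      · simp [hj]
    obtain ⟨k, q, hq, ⟨r, hr⟩, hqN⟩ := ih β (by
      simpa [Finset.sum_add_distrib] using hn)
    obtain ⟨q', hq', hDq⟩ := exists_eval_and_map_eq_pderiv hs hD i q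
    refine ⟨k + 1, Polynomial.C f * q' +
      (Polynomial.X + Polynomial.C (1 - (k : MvPolynomial σ ℚ))) * (Polynomial.C (pderiv i f) * q),
      fun m hm => ?_,
      ⟨pderiv i r, ?_⟩, ?_⟩
    · obtain ⟨j, rfl⟩ : ∃ j, m = j + k := ⟨m - k, by omega⟩
      have hqj := hq' ((j + k : ℕ) : ℤ)
      rw [Int.cast_natCast] at hqj
      rw [← pderiv_pdIter, hq _ (by omega), show j + k + 1 - k = j + 1 by omega,
        show j + k + 1 - (k + 1) = j by omega]
      simp only [Polynomial.eval_add, Polynomial.eval_mul, Polynomial.eval_C, Polynomial.eval_X,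
        hqj, Derivation.leibniz, Derivation.leibniz_pow, smul_eq_mul, nsmul_eq_mul,
        Nat.add_sub_cancel]
      push_cast
      ring
    · have hq1 := hq' (-1)
      rw [Int.cast_neg, Int.cast_one, hr] at hq1
      simp only [Polynomial.eval_add, Polynomial.eval_mul, Polynomial.eval_C, Polynomial.eval_X,
        hq1, hr]
      cases k with
      | zero => simp
      | succ k =>
        simp only [Derivation.leibniz, Derivation.leibniz_pow, smul_eq_mul, nsmul_eq_mul,
          Nat.add_sub_cancel]
        push_cast
        ring
    · have h1 := hND i _ hqN
      rw [hDq, show (1 - k : ℤ) = -k + 1 by ring, hDw, ← hw] at h1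
      convert h1 using 1
      have hC : E (Polynomial.C ((1 : MvPolynomial σ ℚ) - k)) = (1 - k : Module.End F V) := by
        simp
      rw [mul_comm (Polynomial.C f), mul_comm (Polynomial.C (pderiv i f))]
      simp only [map_add, map_mul, LinearMap.add_apply, Module.End.mul_apply, hC, hs,
        LinearMap.sub_apply, Module.End.one_apply, Module.End.natCast_apply, map_smul]
      rw [show (1 - ((k + 1 : ℕ) : ℤ)) = -k by push_cast; ring, add_comm]
      congr 1
      rw [show (s + ((-k : ℤ) : F) + 1) = s + 1 - k by push_cast; ring, sub_smul, add_smul,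
        one_smul, Nat.cast_smul_eq_nsmul]
      abel

lemma map_map_C_apply [Algebra ℚ F]
    (hc : ∀ c v, E (Polynomial.C (MvPolynomial.C c)) v = algebraMap ℚ F c • v)
    (hs : ∀ v, E Polynomial.X v = s • v) (b : ℚ[X]) (v : V) :
    E (b.map MvPolynomial.C) v = Polynomial.aeval s b • v := by
  induction b using Polynomial.induction_on' generalizing v with
  | add p q hp hq => simp only [Polynomial.map_add, map_add, LinearMap.add_apply, hp, hq, add_smul]
  | monomial n a =>
    induction n generalizing v with
    | zero => simp [hc]
    | succ n ih =>
      rw [← Polynomial.monomial_mul_X, Polynomial.map_mul, Polynomial.map_X, map_mul,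
        Module.End.mul_apply, hs, ih, map_mul, Polynomial.aeval_X, smul_smul]

lemma SatisfiesBS.aeval_smul_mem_and_dvd [Fintype σ] [Algebra ℚ F] {b : ℚ[X]}
    (hb : SatisfiesBS f 1 b) (hf : f ≠ 0)
    (hc : ∀ c v, E (Polynomial.C (MvPolynomial.C c)) v = algebraMap ℚ F c • v)
    (hs : ∀ v, E Polynomial.X v = s • v)
    (hD : ∀ i h v, D i (E (Polynomial.C h) v) =
      E (Polynomial.C h) (D i v) + E (Polynomial.C (pderiv i h)) v)
    (hw : ∀ i, E (Polynomial.C f) (w i) = w (i + 1))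
    (hDw : ∀ l i, D l (w (i + 1)) = (s + i + 1) • E (Polynomial.C (pderiv l f)) (w i))
    (hN : w 1 ∈ N) (hND : ∀ l, ∀ v ∈ N, D l v ∈ N) (hNE : ∀ p, ∀ v ∈ N, E p v ∈ N) :
    Polynomial.aeval s b • w 0 ∈ N ∧ f ∣ MvPolynomial.C (b.eval (-1)) := by
  classical
  obtain ⟨A, p, hp⟩ := hb
  choose k q hq hqd hqN using exists_pdIter_pow_eq hs hD hw hDw hN hND
  obtain ⟨K, hK⟩ : ∃ K, ∀ α ∈ A, k α ≤ K := ⟨A.sup k, fun α hα => Finset.le_sup hα⟩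
  have key : b.map MvPolynomial.C * Polynomial.C f ^ K =
      ∑ α ∈ A, p α * (q α * Polynomial.C f ^ (K + 1 - k α)) := by
    refine Polynomial.eq_of_infinite_eval_eq _ _ (Set.Infinite.mono ?_
      ((Set.Ici_infinite K).image (Nat.cast_injective (R := MvPolynomial σ ℚ)).injOn))
    rintro _ ⟨m, hm, rfl⟩
    obtain ⟨j, rfl⟩ := Nat.exists_eq_add_of_le (Set.mem_Ici.1 hm)
    refine mul_right_cancel₀ (pow_ne_zero j hf) ?_
    have h := hp (K + j)
    rw [mul_one, pow_add, ← mul_assoc, ← Polynomial.eval_map_apply, map_natCast] at h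
    rw [Polynomial.eval_mul, Polynomial.eval_pow, Polynomial.eval_C, h, Polynomial.eval_finsetSum,
      Finset.sum_mul]
    refine Finset.sum_congr rfl fun α hα => ?_
    have hα := hK α hα
    rw [one_mul, hq α _ (by omega), show K + j + 1 - k α = K + 1 - k α + j by omega, pow_add]
    simp only [Polynomial.eval_mul, Polynomial.eval_pow, Polynomial.eval_C]
    ring
  constructor
  · have hwn (n : ℕ) (i : ℤ) : E (Polynomial.C f ^ n) (w i) = w (i + n) := by
      induction n generalizing i with
      | zero => simp
      | succ n ih =>
        rw [pow_succ, map_mul, Module.End.mul_apply, hw, ih]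
        congr 1
        push_cast
        ring
    have h := congr(E $key (w (-K)))
    rw [map_mul, Module.End.mul_apply, hwn, map_map_C_apply hc hs, neg_add_cancel] at h
    rw [h, map_sum, LinearMap.sum_apply]
    refine N.sum_mem fun α hα => ?_
    rw [map_mul, map_mul, Module.End.mul_apply, Module.End.mul_apply, hwn]
    refine hNE _ _ ?_
    convert hqN α using 3
    have := hK α hα
    omega
  · have h := congr(Polynomial.eval (-1) $key)
    rw [Polynomial.eval_mul, Polynomial.eval_pow, Polynomial.eval_C, Polynomial.eval_finsetSum,
      show (-1 : MvPolynomial σ ℚ) = MvPolynomial.C (-1) by simp, Polynomial.eval_map_apply] at h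
    refine (mul_dvd_mul_iff_right (pow_ne_zero K hf)).1 ?_
    rw [h, ← pow_succ']
    refine Finset.dvd_sum fun α hα => ?_
    have := hK α hα
    simp only [Polynomial.eval_mul, Polynomial.eval_pow, Polynomial.eval_C]
    rw [show K + 1 = k α + (K + 1 - k α) by omega, pow_add, Nat.add_sub_cancel_left]
    exact (mul_dvd_mul (by simpa using hqd α) dvd_rfl).mul_left _

end Specialization

section TwistedSeries

/-- Families of coefficients `c a b n`, standing for `∑ c a b n • x ^ (e + a) z ^ (e + b) ηₙ`
where `y ηₙ₊₁ = ηₙ` and `∂_y ηₙ = -(n + 1) ηₙ₊₁`. -/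
abbrev TwistedSeries (F : Type*) := ℤ → ℤ → ℕ → F

namespace TwistedSeries

variable {F : Type*} [Field F]

/-- Multiplication by a monomial. -/
def shift (F : Type*) [Field F] (d : Fin 3 →₀ ℕ) : Module.End F (TwistedSeries F) where
  toFun c a b n := c (a - d 0) (b - d 2) (n + d 1)
  map_add' _ _ := rfl
  map_smul' _ _ := rfl

lemma shift_apply (d : Fin 3 →₀ ℕ) (c : TwistedSeries F) (a b : ℤ) (n : ℕ) :
    shift F d c a b n = c (a - d 0) (b - d 2) (n + d 1) := rfl

/-- The partial derivatives. -/
def deriv (e : F) : Fin 3 → Module.End F (TwistedSeries F) :=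
  ![{ toFun c a b n := (e + a + 1) * c (a + 1) b n
      map_add' _ _ := by ext; simp [mul_add]
      map_smul' _ _ := by ext; simp [mul_left_comm] },
    { toFun c a b n := -(n : F) * c a b (n - 1)
      map_add' _ _ := by ext; simp [mul_add]
      map_smul' _ _ := by ext; simp [mul_left_comm] },
    { toFun c a b n := (e + b + 1) * c a (b + 1) n
      map_add' _ _ := by ext; simp [mul_add]
      map_smul' _ _ := by ext; simp [mul_left_comm] }]

lemma deriv_zero_apply (e : F) (c : TwistedSeries F) (a b : ℤ) (n : ℕ) :
    deriv e 0 c a b n = (e + a + 1) * c (a + 1) b n := rfl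

lemma deriv_one_apply (e : F) (c : TwistedSeries F) (a b : ℤ) (n : ℕ) :
    deriv e 1 c a b n = -(n : F) * c a b (n - 1) := rfl

lemma deriv_two_apply (e : F) (c : TwistedSeries F) (a b : ℤ) (n : ℕ) :
    deriv e 2 c a b n = (e + b + 1) * c a (b + 1) n := rfl

lemma exists_int_recurrence (u : ℤ → F) (hu : ∀ k, u k ≠ 0) :
    ∃ g : ℤ → F, g 0 = 1 ∧ ∀ k, g (k + 1) = u k * g k := by
  refine ⟨fun k => match k with
    | .ofNat n => ∏ i ∈ Finset.range n, u i
    | .negSucc n => (∏ i ∈ Finset.range (n + 1), u (-(i + 1)))⁻¹, by simp, ?_⟩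
  rintro (n | n)
  · exact (Finset.prod_range_succ _ _).trans (mul_comm _ _)
  · rcases n with _ | n
    · simp [hu]
    · have hn := hu (-(((n + 1 : ℕ) : ℤ) + 1))
      change (∏ i ∈ Finset.range (n + 1), u (-(i + 1)))⁻¹ = u (-(((n + 1 : ℕ) : ℤ) + 1)) * _
      simp only [Finset.prod_range_succ _ (n + 1), mul_inv_rev]
      rw [mul_inv_cancel_left₀ hn]

/-- Coefficients of a formal model of the powers `f ^ (s + i)` for `f = x³z³ + y³z² + y²`. -/
structure PowerCoeffs (s : F) where
  A : ℤ → F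
  I : ℤ → F
  C : ℤ → F
  H : ℤ → F
  A_succ (k : ℤ) : A (k + 1) = -(k + 1 / 2) * A k
  I_pred (j : ℤ) : I (j - 1) = j * I j
  C_pred (p : ℤ) : C (p - 1) = (s + 1 / 2 + p) * C p
  H_succ (i : ℤ) : H (i + 1) = (s + i + 1) * H i

namespace PowerCoeffs

variable {s : F} (W : PowerCoeffs s)

/-- The formal model of `f ^ (s + i)`. -/
def series (i : ℤ) : TwistedSeries F := fun a b n =>
  if 3 ∣ a ∧ 2 ∣ b - a ∧ (n : ℤ) = 2 * (a / 3 - i) - (b - a) / 2 then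
    W.A (a / 3 - i + (b - a) / 2) * W.I ((b - a) / 2) * W.C (a / 3) * W.H i else 0

lemma series_of_not_dvd {i a b : ℤ} {n : ℕ} (h : ¬(3 ∣ a ∧ 2 ∣ b - a)) : W.series i a b n = 0 :=
  if_neg fun h' => h ⟨h'.1, h'.2.1⟩

lemma series_apply {i a b : ℤ} {n : ℕ} (p j : ℤ) (ha : a = 3 * p) (hb : b = 3 * p + 2 * j) :
    W.series i a b n = if (n : ℤ) = 2 * (p - i) - j then
      W.A (p - i + j) * W.I j * W.C p * W.H i else 0 := by
  subst ha hb
  simp [series]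

end PowerCoeffs

/-- The number of factors `t` demanded of a coefficient with exponent `a`. -/
def weight (r a : ℤ) : ℕ := if a ≤ r then 1 else 0

/-- The families whose coefficients are integral, and divisible by `t` once for each exponent at
most `r`. -/
def lattice (O : Subring F) (t δ : F) (r : ℤ) : AddSubgroup (TwistedSeries F) where
  carrier := {c | ∀ a b n, ∃ o ∈ O, δ * c a b n = t ^ (weight r a + weight r b) * o}
  zero_mem' _ _ _ := ⟨0, O.zero_mem, by simp⟩
  add_mem' {c c'} hc hc' a b n := by
    obtain ⟨o, ho, h⟩ := hc a b n
    obtain ⟨o', ho', h'⟩ := hc' a b n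
    exact ⟨o + o', O.add_mem ho ho', by simp only [Pi.add_apply]; rw [mul_add, h, h', mul_add]⟩
  neg_mem' {c} hc a b n := by
    obtain ⟨o, ho, h⟩ := hc a b n
    exact ⟨-o, O.neg_mem ho, by simp [h]⟩

section Lattice

variable {O : Subring F} {t δ : F} {r : ℤ}

lemma smul_mem_lattice {x : F} (hx : x ∈ O) {c : TwistedSeries F} (hc : c ∈ lattice O t δ r) :
    x • c ∈ lattice O t δ r := fun a b n => by
  obtain ⟨o, ho, h⟩ := hc a b n
  exact ⟨x * o, O.mul_mem hx ho, by
    simp only [Pi.smul_apply, smul_eq_mul]; rw [mul_left_comm, h, mul_left_comm]⟩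

lemma shift_mem_lattice (ht : t ∈ O) (d : Fin 3 →₀ ℕ) {c : TwistedSeries F}
    (hc : c ∈ lattice O t δ r) : shift F d c ∈ lattice O t δ r := fun a b n => by
  obtain ⟨o, ho, h⟩ := hc (a - d 0) (b - d 2) (n + d 1)
  have hle (a : ℤ) (k : ℕ) : weight r a ≤ weight r (a - k) := by
    simp only [weight]; split_ifs <;> omega
  obtain ⟨k, hk⟩ := Nat.exists_eq_add_of_le (add_le_add (hle a (d 0)) (hle b (d 2)))
  exact ⟨t ^ k * o, O.mul_mem (O.pow_mem ht k) ho, by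
    rw [shift_apply, h, hk, pow_add, mul_assoc]⟩

lemma exists_mul_pow_weight_eq (ht : t ∈ O) (a : ℤ) :
    ∃ o ∈ O, (3 * t - 1 - r + a + 1) * t ^ weight r (a + 1) = t ^ weight r a * o := by
  rcases eq_or_ne a r with rfl | har
  · refine ⟨3, by simp, ?_⟩
    simp [weight]
    ring
  · refine ⟨3 * t - 1 - r + a + 1, ?_, ?_⟩
    · have h3 : (3 : F) ∈ O := by simp
      exact O.add_mem (O.add_mem (O.sub_mem (O.sub_mem (O.mul_mem h3 ht) O.one_mem)
        (intCast_mem O _)) (intCast_mem O _)) O.one_mem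
    · rw [show weight r (a + 1) = weight r a by simp only [weight]; congr 1; simp; omega, mul_comm]

lemma deriv_mem_lattice (ht : t ∈ O) (i : Fin 3) {c : TwistedSeries F}
    (hc : c ∈ lattice O t δ r) : deriv (3 * t - 1 - r) i c ∈ lattice O t δ r := by
  intro a b n
  fin_cases i
  · obtain ⟨o, ho, h⟩ := hc (a + 1) b n
    obtain ⟨o', ho', h'⟩ := exists_mul_pow_weight_eq (r := r) ht a
    refine ⟨o' * o, O.mul_mem ho' ho, ?_⟩
    change δ * ((3 * t - 1 - r + a + 1) * c (a + 1) b n) = _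
    rw [pow_add] at h ⊢
    linear_combination (3 * t - 1 - r + a + 1) * h + t ^ weight r b * o * h'
  · obtain ⟨o, ho, h⟩ := hc a b (n - 1)
    refine ⟨-n * o, O.mul_mem (O.neg_mem (natCast_mem O n)) ho, ?_⟩
    change δ * (-(n : F) * c a b (n - 1)) = _
    linear_combination (-(n : F)) * h
  · obtain ⟨o, ho, h⟩ := hc a (b + 1) n
    obtain ⟨o', ho', h'⟩ := exists_mul_pow_weight_eq (r := r) ht b
    refine ⟨o' * o, O.mul_mem ho' ho, ?_⟩
    change δ * ((3 * t - 1 - r + b + 1) * c a (b + 1) n) = _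
    rw [pow_add] at h ⊢
    linear_combination (3 * t - 1 - r + b + 1) * h + t ^ weight r a * o * h'

lemma PowerCoeffs.series_one_mem_lattice {s : F} (W : PowerCoeffs s) (hr : r ≤ 2)
    (hA : ∀ k, W.A k ∈ O) (hI : ∀ k, W.I k ∈ O) (hI' : ∀ k < 0, W.I k = 0)
    (hC : ∀ k > 0, δ * W.C k ∈ O) (hH : W.H 1 ∈ O) : W.series 1 ∈ lattice O t δ r := by
  intro a b n
  by_cases h : 3 ∣ a ∧ 2 ∣ b - a
  · obtain ⟨⟨p, rfl⟩, j, hj⟩ := h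
    obtain rfl := sub_eq_iff_eq_add'.1 hj
    rw [W.series_apply p j rfl rfl]
    split_ifs with hn
    · rcases lt_or_ge j 0 with hj0 | hj0
      · exact ⟨0, O.zero_mem, by simp [hI' j hj0]⟩
      · refine ⟨W.A (p - 1 + j) * W.I j * (δ * W.C p) * W.H 1,
          O.mul_mem (O.mul_mem (O.mul_mem (hA _) (hI _)) (hC p (by omega))) hH, ?_⟩
        rw [weight, weight, if_neg (by omega), if_neg (by omega)]
        ring
    · exact ⟨0, O.zero_mem, by simp⟩
  · exact ⟨0, O.zero_mem, by simp [W.series_of_not_dvd h]⟩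

end Lattice

variable [Algebra ℚ F]

/-- The action of polynomials. -/
noncomputable def polyAction (F : Type*) [Field F] [Algebra ℚ F] :
    MvPolynomial (Fin 3) ℚ →ₐ[ℚ] Module.End F (TwistedSeries F) :=
  AddMonoidAlgebra.lift ℚ _ _
    { toFun d := shift F d.toAdd
      map_one' := by ext; simp [shift_apply]
      map_mul' d d' := by
        ext c a b n
        simp only [Module.End.mul_apply, shift_apply, toAdd_mul, Finsupp.add_apply, Nat.cast_add]
        congr 1
        · ring
        · ring
        · ring }

lemma polyAction_monomial (d : Fin 3 →₀ ℕ) (r : ℚ) :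
    polyAction F (MvPolynomial.monomial d r) = r • shift F d :=
  AddMonoidAlgebra.lift_single _ _ _

lemma polyAction_C_apply (r : ℚ) (c : TwistedSeries F) :
    polyAction F (MvPolynomial.C r) c = algebraMap ℚ F r • c := by
  rw [← MvPolynomial.algebraMap_eq, AlgHom.commutes]
  ext
  simp [Algebra.smul_def]

lemma polyAction_X_zero_apply (c : TwistedSeries F) (a b : ℤ) (n : ℕ) :
    polyAction F (X 0) c a b n = c (a - 1) b n := by
  simp [MvPolynomial.X, polyAction_monomial, shift_apply]

lemma polyAction_X_one_apply (c : TwistedSeries F) (a b : ℤ) (n : ℕ) :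
    polyAction F (X 1) c a b n = c a b (n + 1) := by
  simp [MvPolynomial.X, polyAction_monomial, shift_apply]

lemma polyAction_X_two_apply (c : TwistedSeries F) (a b : ℤ) (n : ℕ) :
    polyAction F (X 2) c a b n = c a (b - 1) n := by
  simp [MvPolynomial.X, polyAction_monomial, shift_apply]

lemma deriv_polyAction (e : F) (i : Fin 3) (h : MvPolynomial (Fin 3) ℚ) (c : TwistedSeries F) :
    deriv e i (polyAction F h c) =
      polyAction F h (deriv e i c) + polyAction F (pderiv i h) c := by
  induction h using MvPolynomial.induction_on generalizing c with
  | C r => simp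
  | add p q hp hq =>
    simp only [map_add, LinearMap.add_apply, hp, hq]
    abel
  | mul_X p j hp =>
    have hX (c : TwistedSeries F) : deriv e i (polyAction F (X j) c) =
        polyAction F (X j) (deriv e i c) + polyAction F (pderiv i (X j)) c := by
      ext a b n
      fin_cases i <;> fin_cases j <;>
        simp [polyAction_X_zero_apply, polyAction_X_one_apply, polyAction_X_two_apply,
          deriv_zero_apply, deriv_one_apply, deriv_two_apply, pderiv_X] <;> ring_nf
      cases n <;> simp [add_comm]
    rw [map_mul, Module.End.mul_apply, hp, hX, Derivation.leibniz, smul_eq_mul, smul_eq_mul]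
    simp only [map_add, map_mul, LinearMap.add_apply, Module.End.mul_apply]
    rw [show polyAction F (X j) (polyAction F (pderiv i p) c) =
      polyAction F (pderiv i p) (polyAction F (X j) c) by
        rw [← Module.End.mul_apply, ← map_mul, mul_comm, map_mul, Module.End.mul_apply]]
    abel

lemma polyAction_X_zero_pow_apply (k : ℕ) (c : TwistedSeries F) (a b : ℤ) (n : ℕ) :
    (polyAction F (X 0) ^ k) c a b n = c (a - k) b n := by
  induction k generalizing a with
  | zero => simp
  | succ k ih => rw [pow_succ', Module.End.mul_apply, polyAction_X_zero_apply, ih]; grind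

lemma polyAction_X_one_pow_apply (k : ℕ) (c : TwistedSeries F) (a b : ℤ) (n : ℕ) :
    (polyAction F (X 1) ^ k) c a b n = c a b (n + k) := by
  induction k generalizing n with
  | zero => simp
  | succ k ih => rw [pow_succ', Module.End.mul_apply, polyAction_X_one_apply, ih]; grind

lemma polyAction_X_two_pow_apply (k : ℕ) (c : TwistedSeries F) (a b : ℤ) (n : ℕ) :
    (polyAction F (X 2) ^ k) c a b n = c a (b - k) n := by
  induction k generalizing b with
  | zero => simp
  | succ k ih => rw [pow_succ', Module.End.mul_apply, polyAction_X_two_apply, ih]; grind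

namespace PowerCoeffs

variable {s : F} (W : PowerCoeffs s)

lemma polyAction_series [CharZero F] (i : ℤ) :
    polyAction F bsPoly (W.series i) = W.series (i + 1) := by
  ext a b n
  simp only [bsPoly, map_add, map_mul, map_pow, LinearMap.add_apply, Module.End.mul_apply,
    Pi.add_apply, polyAction_X_zero_pow_apply, polyAction_X_one_pow_apply,
    polyAction_X_two_pow_apply]
  by_cases h : 3 ∣ a ∧ 2 ∣ b - a
  · obtain ⟨⟨p, rfl⟩, j, hj⟩ := h
    obtain rfl := sub_eq_iff_eq_add'.1 hj
    rw [W.series_apply (p - 1) j (by grind) (by grind),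
      W.series_apply p (j - 1) (by grind) (by grind),
      W.series_apply p j (by grind) (by grind), W.series_apply p j (by grind) (by grind)]
    by_cases hn : (n : ℤ) = 2 * (p - (i + 1)) - j
    · rw [if_pos (by grind), if_pos (by grind), if_pos (by grind), if_pos hn]
      have h1 := W.A_succ (p - 1 - i + j)
      rw [show p - 1 - i + j + 1 = p - i + j by ring] at h1
      rw [show p - i + (j - 1) = p - 1 - i + j by ring,
        show p - (i + 1) + j = p - 1 - i + j by ring, h1, W.I_pred, W.C_pred, W.H_succ]
      push_cast
      ring
    · rw [if_neg (by grind), if_neg (by grind), if_neg (by grind), if_neg hn]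
      simp
  · rw [W.series_of_not_dvd h, W.series_of_not_dvd h, W.series_of_not_dvd (by grind),
      W.series_of_not_dvd (by grind)]
    simp

lemma deriv_zero_series [CharZero F] (i : ℤ) : deriv (3 * s + 3 / 2) 0 (W.series (i + 1)) =
    (s + i + 1) • polyAction F (pderiv 0 bsPoly) (W.series i) := by
  ext a b n
  simp only [pderiv_zero_bsPoly, map_ofNat, map_mul, map_pow, Module.End.mul_apply,
    Pi.smul_apply, polyAction_X_zero_pow_apply, Module.End.ofNat_apply, deriv_zero_apply,
    polyAction_X_two_pow_apply, smul_eq_mul, nsmul_eq_mul, Pi.mul_apply, Pi.ofNat_apply,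
    Nat.cast_ofNat]
  by_cases h : 3 ∣ a + 1 ∧ 2 ∣ b - (a + 1)
  · obtain ⟨⟨p, hp⟩, j, hj⟩ := h
    obtain rfl := eq_sub_iff_add_eq.2 hp
    rw [W.series_apply p j (by grind) (by grind), W.series_apply (p - 1) j (by grind) (by grind)]
    by_cases hn : (n : ℤ) = 2 * (p - (i + 1)) - j
    · rw [if_pos (by grind), if_pos (by grind)]
      rw [show p - 1 - i + j = p - (i + 1) + j by ring, W.C_pred, W.H_succ]
      push_cast
      ring
    · rw [if_neg (by grind), if_neg (by grind)]
      simp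
  · rw [W.series_of_not_dvd h, W.series_of_not_dvd (by grind)]
    simp

lemma deriv_one_series [CharZero F] (i : ℤ) : deriv (3 * s + 3 / 2) 1 (W.series (i + 1)) =
    (s + i + 1) • polyAction F (pderiv 1 bsPoly) (W.series i) := by
  ext a b n
  simp only [pderiv_one_bsPoly, map_ofNat, map_mul, map_pow, map_add, Module.End.mul_apply,
    Pi.smul_apply, Pi.add_apply, polyAction_X_one_apply, polyAction_X_one_pow_apply,
    Module.End.ofNat_apply, deriv_one_apply, LinearMap.add_apply,
    polyAction_X_two_pow_apply, smul_eq_mul, nsmul_eq_mul, Pi.mul_apply, Pi.ofNat_apply,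
    Nat.cast_ofNat]
  by_cases h : 3 ∣ a ∧ 2 ∣ b - a
  · obtain ⟨⟨p, rfl⟩, j, hj⟩ := h
    obtain rfl := sub_eq_iff_eq_add'.1 hj
    rw [W.series_apply p j (by grind) (by grind), W.series_apply p j (by grind) (by grind),
      W.series_apply p (j - 1) (by grind) (by grind)]
    by_cases hn : (n : ℤ) = 2 * (p - i) - j - 1
    · rw [if_pos (show ((n + 1 : ℕ) : ℤ) = _ by grind),
        if_pos (show ((n + 2 : ℕ) : ℤ) = _ by grind)]
      have h1 := W.A_succ (p - (i + 1) + j)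
      rw [show p - (i + 1) + j + 1 = p - i + j by ring] at h1
      have hn' : (n : F) = 2 * (p - i) - j - 1 := by exact_mod_cast congr(($hn : F))
      rw [show p - i + (j - 1) = p - (i + 1) + j by ring, h1, W.I_pred, W.H_succ]
      have h2 : (n : F) * (if ((n - 1 : ℕ) : ℤ) = 2 * (p - (i + 1)) - j then
          W.A (p - (i + 1) + j) * W.I j * W.C p * ((s + i + 1) * W.H i) else 0) =
          n * (W.A (p - (i + 1) + j) * W.I j * W.C p * ((s + i + 1) * W.H i)) := by
        cases n with
        | zero => simp
        | succ n => rw [if_pos (by grind)]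
      rw [neg_mul, h2, hn']
      push_cast
      ring
    · rw [if_neg (show ¬((n + 1 : ℕ) : ℤ) = _ by grind),
        if_neg (show ¬((n + 2 : ℕ) : ℤ) = _ by grind)]
      cases n with
      | zero => simp
      | succ n => rw [if_neg (by grind)]; simp
  · rw [W.series_of_not_dvd h, W.series_of_not_dvd h, W.series_of_not_dvd (by grind)]
    simp

lemma deriv_two_series [CharZero F] (i : ℤ) : deriv (3 * s + 3 / 2) 2 (W.series (i + 1)) =
    (s + i + 1) • polyAction F (pderiv 2 bsPoly) (W.series i) := by
  ext a b n
  simp only [pderiv_two_bsPoly, map_ofNat, map_mul, map_pow, map_add, Module.End.mul_apply,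
    Pi.smul_apply, Pi.add_apply, polyAction_X_two_apply, polyAction_X_zero_pow_apply,
    polyAction_X_one_pow_apply, Module.End.ofNat_apply, deriv_two_apply, LinearMap.add_apply,
    polyAction_X_two_pow_apply, smul_eq_mul, nsmul_eq_mul, Pi.mul_apply, Pi.ofNat_apply,
    Nat.cast_ofNat]
  by_cases h : 3 ∣ a ∧ 2 ∣ b + 1 - a
  · obtain ⟨⟨p, rfl⟩, j, hj⟩ := h
    obtain rfl : b = 3 * p + 2 * j - 1 := by grind
    rw [W.series_apply p j (by grind) (by grind), W.series_apply (p - 1) j (by grind) (by grind),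
      W.series_apply p (j - 1) (by grind) (by grind)]
    by_cases hn : (n : ℤ) = 2 * (p - (i + 1)) - j
    · rw [if_pos (by grind), if_pos (by grind), if_pos (by grind)]
      rw [show p - 1 - i + j = p - (i + 1) + j by ring,
        show p - i + (j - 1) = p - (i + 1) + j by ring, W.C_pred, W.I_pred, W.H_succ]
      push_cast
      ring
    · rw [if_neg (by grind), if_neg (by grind), if_neg (by grind)]
      simp
  · rw [W.series_of_not_dvd h, W.series_of_not_dvd (by grind), W.series_of_not_dvd (by grind)]
    simp

end PowerCoeffs

/-- The action of `ℚ[x, y, z][s]` with the variable `s` acting by a scalar. -/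
noncomputable def polynomialAction (s : F) :
    (MvPolynomial (Fin 3) ℚ)[X] →+* Module.End F (TwistedSeries F) :=
  Polynomial.eval₂RingHom' (polyAction F : MvPolynomial (Fin 3) ℚ →+* _)
    (algebraMap F _ s) fun _ => (Algebra.commutes s _).symm

lemma polynomialAction_C (s : F) (h : MvPolynomial (Fin 3) ℚ) :
    polynomialAction s (Polynomial.C h) = polyAction F h :=
  Polynomial.eval₂_C _ _

lemma polynomialAction_X_apply (s : F) (c : TwistedSeries F) :
    polynomialAction s Polynomial.X c = s • c := by
  rw [show polynomialAction s Polynomial.X = algebraMap F _ s from Polynomial.eval₂_X _ _,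
    Module.algebraMap_end_apply]

variable {O : Subring F} {t δ : F} {r : ℤ}

lemma polynomialAction_mem_lattice (hO : ∀ q : ℚ, algebraMap ℚ F q ∈ O) (ht : t ∈ O)
    {s : F} (hs : s ∈ O) (p : (MvPolynomial (Fin 3) ℚ)[X]) {c : TwistedSeries F}
    (hc : c ∈ lattice O t δ r) : polynomialAction s p c ∈ lattice O t δ r := by
  induction p using Polynomial.induction_on generalizing c with
  | C h =>
    rw [polynomialAction_C]
    induction h using MvPolynomial.induction_on' with
    | monomial d q =>
      rw [polyAction_monomial, show (q • shift F d) c = algebraMap ℚ F q • shift F d c by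
        ext a b n; exact Algebra.smul_def q (shift F d c a b n)]
      exact smul_mem_lattice (hO q) (shift_mem_lattice ht d hc)
    | add p q hp hq =>
      rw [map_add]
      exact add_mem hp hq
  | add p q hp hq =>
    rw [map_add]
    exact add_mem (hp hc) (hq hc)
  | monomial n h ih =>
    rw [pow_succ, ← mul_assoc, map_mul, Module.End.mul_apply, polynomialAction_X_apply]
    exact ih (smul_mem_lattice hs hc)

lemma exists_mul_aeval_eq_and_dvd [CharZero F] {s : F} (W : PowerCoeffs s) {b : ℚ[X]}
    (hb : SatisfiesBS bsPoly 1 b) (hr0 : 0 ≤ r) (hr : r ≤ 2)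
    (hO : ∀ q : ℚ, algebraMap ℚ F q ∈ O) (ht : t ∈ O) (hs : s = t - 5 / 6 - r / 3)
    (hA : ∀ k, W.A k ∈ O) (hI : ∀ k, W.I k ∈ O) (hI' : ∀ k < 0, W.I k = 0)
    (hC : ∀ k > 0, δ * W.C k ∈ O) (hA0 : W.A 0 = 1) (hI0 : W.I 0 = 1) (hC0 : W.C 0 = 1)
    (hH0 : W.H 0 = 1) :
    (∃ o ∈ O, δ * Polynomial.aeval s b = t ^ 2 * o) ∧ bsPoly ∣ MvPolynomial.C (b.eval (-1)) := by
  have hsO : s ∈ O := by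
    have h := hO (5 / 6 + r / 3)
    convert O.sub_mem ht h using 1
    rw [hs]
    simp
    ring
  have hH : W.H 1 ∈ O := by
    rw [← zero_add (1 : ℤ), W.H_succ, hH0]
    simpa using O.add_mem hsO O.one_mem
  have he : 3 * s + 3 / 2 = 3 * t - 1 - r := by rw [hs]; ring
  obtain ⟨h, hdvd⟩ := hb.aeval_smul_mem_and_dvd (E := polynomialAction s)
    (D := deriv (3 * s + 3 / 2)) (s := s) (w := W.series) (N := lattice O t δ r) bsPoly_ne_zero
    (fun q c => by rw [polynomialAction_C, polyAction_C_apply])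
    (polynomialAction_X_apply s)
    (fun i h c => by simp only [polynomialAction_C]; exact deriv_polyAction _ _ _ _)
    (fun i => by rw [polynomialAction_C]; exact W.polyAction_series i)
    (fun l i => by
      rw [polynomialAction_C]
      fin_cases l
      exacts [W.deriv_zero_series i, W.deriv_one_series i, W.deriv_two_series i])
    (W.series_one_mem_lattice hr hA hI hI' hC hH)
    (fun l c hc => by rw [he]; exact deriv_mem_lattice ht l hc)
    (fun p c hc => polynomialAction_mem_lattice hO ht hsO p hc)
  obtain ⟨o, ho, h⟩ := h 0 0 0
  refine ⟨⟨o, ho, ?_⟩, hdvd⟩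
  simpa [weight, hr0, W.series_apply 0 0, hA0, hI0, hC0, hH0] using h
lemma exists_powerCoeffs [CharZero F] {s : F} (hs : ∀ q : ℚ, s + algebraMap ℚ F q ≠ 0) :
    ∃ W : PowerCoeffs s, (∀ k, ∃ q : ℚ, W.A k = algebraMap ℚ F q) ∧
      (∀ k, ∃ q : ℚ, W.I k = algebraMap ℚ F q) ∧ (∀ k < 0, W.I k = 0) ∧
      W.A 0 = 1 ∧ W.I 0 = 1 ∧ W.C 0 = 1 ∧ W.H 0 = 1 := by
  obtain ⟨A, hA0, hA⟩ := exists_int_recurrence (fun k => -((k : ℚ) + 1 / 2)) fun k h => by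
    have h2 : 2 * k + 1 = 0 := by
      have : 2 * (k : ℚ) + 1 = 0 := by linear_combination -2 * h
      exact_mod_cast this
    omega
  obtain ⟨C, hC0, hC⟩ := exists_int_recurrence (fun k => (s + algebraMap ℚ F (3 / 2 + k))⁻¹)
    fun k => inv_ne_zero (hs _)
  obtain ⟨H, hH0, hH⟩ := exists_int_recurrence (fun k => s + algebraMap ℚ F (k + 1))
    fun k => hs _
  refine ⟨⟨fun k => algebraMap ℚ F (A k),
    fun j => algebraMap ℚ F (if 0 ≤ j then (j.toNat.factorial : ℚ)⁻¹ else 0), C, H,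
    fun k => ?_, fun j => ?_, fun p => ?_, fun i => ?_⟩, fun k => ⟨_, rfl⟩, fun k => ⟨_, rfl⟩,
    fun k hk => ?_, ?_, ?_, hC0, hH0⟩
  · rw [hA]
    simp
  · rcases lt_trichotomy j 0 with hj | rfl | hj
    · rw [if_neg (by omega), if_neg (by omega)]
      simp
    · simp
    · obtain ⟨n, rfl⟩ : ∃ n : ℕ, j = n + 1 := ⟨(j - 1).toNat, by omega⟩
      have hn : (n : F) + 1 ≠ 0 := by exact_mod_cast n.succ_ne_zero
      rw [show (n : ℤ) + 1 - 1 = n by ring, if_pos (by omega), if_pos (by omega),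
        show ((n : ℤ) + 1).toNat = n + 1 by omega, Nat.factorial_succ]
      simp
      field_simp
  · have h := hC (p - 1)
    rw [sub_add_cancel] at h
    rw [h, show s + 1 / 2 + p = s + algebraMap ℚ F (3 / 2 + (p - 1 : ℤ)) by
      simp
      ring, mul_inv_cancel_left₀ (hs _)]
  · rw [hH]
    simp [add_assoc]
  · simp [hk.not_ge]
  · simp [hA0]
  · simp

/-- The local ring of `ℚ[s]` at the point `a`, inside the field of rational functions. -/
def regularAt (a : ℚ) : Subring (FractionRing ℚ[X]) where
  carrier := {x | ∃ p q : ℚ[X], q.eval a ≠ 0 ∧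
    x * algebraMap ℚ[X] (FractionRing ℚ[X]) q = algebraMap ℚ[X] (FractionRing ℚ[X]) p}
  zero_mem' := ⟨0, 1, by simp⟩
  one_mem' := ⟨1, 1, by simp⟩
  add_mem' := by
    rintro x y ⟨p, q, hq, hx⟩ ⟨p', q', hq', hy⟩
    refine ⟨p * q' + p' * q, q * q', by simp [hq, hq'], ?_⟩
    simp only [map_mul, map_add, ← hx, ← hy]
    ring
  mul_mem' := by
    rintro x y ⟨p, q, hq, hx⟩ ⟨p', q', hq', hy⟩
    refine ⟨p * p', q * q', by simp [hq, hq'], ?_⟩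
    simp only [map_mul, ← hx, ← hy]
    ring
  neg_mem' := by
    rintro x ⟨p, q, hq, hx⟩
    exact ⟨-p, q, hq, by rw [map_neg, ← hx, neg_mul]⟩

lemma algebraMap_mem_regularAt (a : ℚ) (p : ℚ[X]) :
    algebraMap ℚ[X] (FractionRing ℚ[X]) p ∈ regularAt a :=
  ⟨p, 1, by simp⟩

lemma inv_algebraMap_mem_regularAt {a : ℚ} {q : ℚ[X]} (hq : q.eval a ≠ 0) :
    (algebraMap ℚ[X] (FractionRing ℚ[X]) q)⁻¹ ∈ regularAt a :=
  ⟨1, q, hq, by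
    rw [map_one, inv_mul_cancel₀]
    exact (map_ne_zero_iff _ (IsFractionRing.injective _ _)).2 fun h => hq (by simp [h])⟩

lemma dvd_of_algebraMap_eq {a : ℚ} {n : ℕ} {b : ℚ[X]} {x : FractionRing ℚ[X]}
    (hx : x ∈ regularAt a) (h : algebraMap ℚ[X] (FractionRing ℚ[X]) b =
      algebraMap ℚ[X] (FractionRing ℚ[X]) (Polynomial.X - Polynomial.C a) ^ n * x) :
    (Polynomial.X - Polynomial.C a) ^ n ∣ b := by
  obtain ⟨p, q, hq, hpq⟩ := hx
  have hbq : b * q = (Polynomial.X - Polynomial.C a) ^ n * p :=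
    IsFractionRing.injective ℚ[X] (FractionRing ℚ[X]) (by
      rw [map_mul, map_mul, map_pow, h, mul_assoc, hpq])
  have hco : IsCoprime ((Polynomial.X - Polynomial.C a) ^ n) q :=
    .pow_left ((Polynomial.irreducible_X_sub_C a).coprime_iff_not_dvd.2 fun hd =>
      hq (Polynomial.dvd_iff_isRoot.1 hd))
  exact hco.dvd_of_dvd_mul_right ⟨p, hbq⟩

lemma exists_mul_eq_pow_mul_and_dvd {b : ℚ[X]} (hb : SatisfiesBS bsPoly 1 b) {r : ℤ}
    (hr0 : 0 ≤ r) (hr : r ≤ 2) {a : ℚ} (ha : a = -5 / 6 - r / 3) {d : ℚ[X]}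
    (hd : algebraMap ℚ[X] (FractionRing ℚ[X]) d *
      (algebraMap ℚ[X] (FractionRing ℚ[X]) (Polynomial.X + Polynomial.C (3 / 2)))⁻¹ ∈ regularAt a) :
    (∃ x ∈ regularAt a, algebraMap ℚ[X] (FractionRing ℚ[X]) (d * b) =
      algebraMap ℚ[X] (FractionRing ℚ[X]) (Polynomial.X - Polynomial.C a) ^ 2 * x) ∧
      bsPoly ∣ MvPolynomial.C (b.eval (-1)) := by
  have : CharZero (FractionRing ℚ[X]) := algebraRat.charZero _
  have hX (q : ℚ) : algebraMap ℚ[X] (FractionRing ℚ[X]) Polynomial.X +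
      algebraMap ℚ (FractionRing ℚ[X]) q =
        algebraMap ℚ[X] (FractionRing ℚ[X]) (Polynomial.X + Polynomial.C q) := by
    rw [map_add, IsScalarTower.algebraMap_apply ℚ ℚ[X] (FractionRing ℚ[X])]
    rfl
  have hX0 (q : ℚ) : algebraMap ℚ[X] (FractionRing ℚ[X])
      (Polynomial.X + Polynomial.C q) ≠ 0 :=
    (map_ne_zero_iff _ (IsFractionRing.injective _ _)).2 (Polynomial.X_add_C_ne_zero q)
  obtain ⟨W, hA, hI, hI', hA0, hI0, hC0, hH0⟩ :=
    exists_powerCoeffs (s := algebraMap ℚ[X] (FractionRing ℚ[X]) Polynomial.X) fun q => by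
      rw [hX]
      exact hX0 q
  have hO (q : ℚ) : algebraMap ℚ (FractionRing ℚ[X]) q ∈ regularAt a := by
    rw [IsScalarTower.algebraMap_apply ℚ ℚ[X] (FractionRing ℚ[X])]
    exact algebraMap_mem_regularAt _ _
  have hC (k : ℤ) : W.C (k + 1) = (algebraMap ℚ[X] (FractionRing ℚ[X])
      (Polynomial.X + Polynomial.C (k + 3 / 2 : ℚ)))⁻¹ * W.C k := by
    have h := W.C_pred (k + 1)
    rw [add_sub_cancel_right] at h
    rw [h, show algebraMap ℚ[X] (FractionRing ℚ[X]) Polynomial.X + 1 / 2 + (k + 1 : ℤ) =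
      algebraMap ℚ[X] (FractionRing ℚ[X]) (Polynomial.X + Polynomial.C (k + 3 / 2 : ℚ)) by
        rw [← hX]
        simp
        ring, inv_mul_cancel_left₀ (hX0 _)]
  have hCO (k : ℕ) : algebraMap ℚ[X] (FractionRing ℚ[X]) d * W.C (k + 1) ∈ regularAt a := by
    induction k with
    | zero =>
      have h := hC 0
      simp only [zero_add, Int.cast_zero, hC0, mul_one] at h
      simpa [h] using hd
    | succ k ih =>
      rw [hC, mul_left_comm]
      refine mul_mem (inv_algebraMap_mem_regularAt ?_) (by exact_mod_cast ih)
      have : (r : ℚ) ≤ 2 := by exact_mod_cast hr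
      simp only [Polynomial.eval_add, Polynomial.eval_X, Polynomial.eval_C, ha]
      push_cast
      refine ne_of_gt ?_
      have : (0 : ℚ) ≤ k := k.cast_nonneg
      linarith
  obtain ⟨⟨x, hx, h⟩, hdvd⟩ := exists_mul_aeval_eq_and_dvd (O := regularAt a)
    (t := algebraMap ℚ[X] (FractionRing ℚ[X]) (Polynomial.X - Polynomial.C a))
    (δ := algebraMap ℚ[X] (FractionRing ℚ[X]) d) W hb hr0 hr hO (algebraMap_mem_regularAt _ _)
    (by
      rw [sub_eq_add_neg (Polynomial.X : ℚ[X]), ← Polynomial.C_neg, ← hX, ha]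
      simp
      ring)
    (fun k => by obtain ⟨q, h⟩ := hA k; rw [h]; exact hO q)
    (fun k => by obtain ⟨q, h⟩ := hI k; rw [h]; exact hO q) hI'
    (fun k hk => by
      convert hCO (k - 1).toNat using 3
      omega) hA0 hI0 hC0 hH0
  refine ⟨⟨x, hx, ?_⟩, hdvd⟩
  rw [map_mul, ← h, Polynomial.aeval_algebraMap_apply, Polynomial.aeval_X_left_apply]

end TwistedSeries
end TwistedSeries

open TwistedSeries

lemma X_sub_C_sq_dvd_of_satisfiesBS {b : ℚ[X]} (hb : SatisfiesBS bsPoly 1 b) {r : ℤ}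
    (hr0 : 0 ≤ r) (hr : r < 2) {a : ℚ} (ha : a = -5 / 6 - r / 3) :
    (Polynomial.X - Polynomial.C a) ^ 2 ∣ b := by
  have h : (r : ℚ) < 2 := by exact_mod_cast hr
  obtain ⟨⟨x, hx, h⟩, -⟩ := exists_mul_eq_pow_mul_and_dvd hb hr0 hr.le ha (d := 1) (by
    rw [map_one, one_mul]
    refine inv_algebraMap_mem_regularAt (ne_of_gt ?_)
    simp only [Polynomial.eval_add, Polynomial.eval_X, Polynomial.eval_C, ha]
    linarith)
  exact dvd_of_algebraMap_eq hx (by rw [← h, one_mul])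

lemma X_sub_C_dvd_of_satisfiesBS {b : ℚ[X]} (hb : SatisfiesBS bsPoly 1 b) :
    Polynomial.X - Polynomial.C (-3 / 2) ∣ b ∧ Polynomial.X - Polynomial.C (-1) ∣ b := by
  have hX : Polynomial.X + Polynomial.C (3 / 2 : ℚ) = Polynomial.X - Polynomial.C (-3 / 2) := by
    rw [sub_eq_add_neg, ← Polynomial.C_neg]
    norm_num
  have h0 : algebraMap ℚ[X] (FractionRing ℚ[X]) (Polynomial.X - Polynomial.C (-3 / 2)) ≠ 0 :=
    (map_ne_zero_iff _ (IsFractionRing.injective _ _)).2 (Polynomial.X_sub_C_ne_zero _)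
  obtain ⟨⟨x, hx, h⟩, hdvd⟩ := exists_mul_eq_pow_mul_and_dvd hb (r := 2) (by norm_num) le_rfl
    (a := -3 / 2) (by norm_num) (d := Polynomial.X - Polynomial.C (-3 / 2)) (by
      rw [hX, mul_inv_cancel₀ h0]
      exact one_mem _)
  constructor
  · rw [← pow_one (Polynomial.X - _)]
    refine dvd_of_algebraMap_eq hx (mul_left_cancel₀ h0 ?_)
    rw [← map_mul, h]
    ring
  · obtain ⟨c, hc⟩ := hdvd
    have h := congr(MvPolynomial.eval 0 $hc)
    rw [Polynomial.dvd_iff_isRoot]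
    simpa [bsPoly] using h

lemma dvd_of_satisfiesBS_bsPoly {b : ℚ[X]} (hb : SatisfiesBS bsPoly 1 b) :
    (Polynomial.X + Polynomial.C (5 / 6 : ℚ)) ^ 2 * (Polynomial.X + Polynomial.C (1 : ℚ)) *
      (Polynomial.X + Polynomial.C (7 / 6 : ℚ)) ^ 2 *
      (Polynomial.X + Polynomial.C (3 / 2 : ℚ)) ∣ b := by
  have hco {p q : ℚ} (h : p ≠ q) :
      IsCoprime (Polynomial.X - Polynomial.C p) (Polynomial.X - Polynomial.C q) :=
    Polynomial.isCoprime_X_sub_C_of_isUnit_sub (sub_ne_zero.2 h).isUnit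
  have hX (q : ℚ) : Polynomial.X + Polynomial.C q = Polynomial.X - Polynomial.C (-q) := by simp
  have h1 : (Polynomial.X - Polynomial.C (-(5 / 6) : ℚ)) ^ 2 ∣ b :=
    X_sub_C_sq_dvd_of_satisfiesBS hb (r := 0) (by norm_num) (by norm_num) (by norm_num)
  have h2 : (Polynomial.X - Polynomial.C (-(7 / 6) : ℚ)) ^ 2 ∣ b :=
    X_sub_C_sq_dvd_of_satisfiesBS hb (r := 1) (by norm_num) (by norm_num) (by norm_num)
  obtain ⟨h3, h4⟩ := X_sub_C_dvd_of_satisfiesBS hb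
  rw [neg_div] at h3
  simp only [hX]
  refine IsCoprime.mul_dvd ?_ (IsCoprime.mul_dvd ?_ (IsCoprime.mul_dvd ?_ h1 h4) h2) h3
  · exact .mul_left (.mul_left (.pow_left (hco (by norm_num))) (hco (by norm_num)))
      (.pow_left (hco (by norm_num)))
  · exact .mul_left (.pow (hco (by norm_num))) (.pow_right (hco (by norm_num)))
  · exact .pow_left (hco (by norm_num))

theorem bernsteinSato_stmt_18 :
    ∀ b : Polynomial ℚ,
      SatisfiesBS ((X 0) ^ 3 * (X 2) ^ 3 + (X 1) ^ 3 * (X 2) ^ 2 + (X 1) ^ 2 : MvPolynomial (Fin 3) ℚ)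
          (1) b ↔
        (Polynomial.X + Polynomial.C (5 / 6 : ℚ)) ^ 2 *
            (Polynomial.X + Polynomial.C (1 : ℚ)) *
            (Polynomial.X + Polynomial.C (7 / 6 : ℚ)) ^ 2 *
            (Polynomial.X + Polynomial.C (3 / 2 : ℚ)) ∣ b :=
  fun _ => ⟨dvd_of_satisfiesBS_bsPoly, satisfiesBS_bsPoly_of_dvd⟩
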